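/- For all n ≥ 1 and all d, l, r ≥ 0, the number of Motzkin permutations π of length n with lds(π) = d, lis(π) = l, and exactly r rises equals the number of Motzkin paths P of length n such that (number of up-steps of P) + (number of horizontal steps of P) = d, the height of P equals l − 1, and the number of up-steps of P equals r. -/

import Mathlib

/-- `π` avoids the classical pattern 132. -/
def Avoids132 {n : ℕ} (π : Equiv.Perm (Fin n)) : Prop :=
  ¬ ∃ i j k : Fin n, i < j ∧ j < k ∧ π i < π k ∧ π k < π j

/-- `π` avoids the generalized pattern 1-23. -/
def Avoids1_23 {n : ℕ} (π : Equiv.Perm (Fin n)) : Prop :=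
  ¬ ∃ (a b : Fin n) (h : (b : ℕ) + 1 < n), a < b ∧ π a < π b ∧ π b < π ⟨(b : ℕ) + 1, h⟩

/-- A Motzkin permutation avoids both 132 and 1-23. -/
def IsMotzkinPerm {n : ℕ} (π : Equiv.Perm (Fin n)) : Prop :=
  Avoids132 π ∧ Avoids1_23 π

/-- Length of the longest decreasing subsequence of `π`. -/
noncomputable def lds {n : ℕ} (π : Equiv.Perm (Fin n)) : ℕ :=
  sSup {m : ℕ | ∃ f : Fin m → Fin n, StrictMono f ∧ StrictAnti fun i => π (f i)}

/-- Length of the longest increasing subsequence of `π`. -/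
noncomputable def lis {n : ℕ} (π : Equiv.Perm (Fin n)) : ℕ :=
  sSup {m : ℕ | ∃ f : Fin m → Fin n, StrictMono f ∧ StrictMono fun i => π (f i)}

/-- The number of rises of `π`: indices `i` with `π i < π (i+1)`. -/
noncomputable def rises {n : ℕ} (π : Equiv.Perm (Fin n)) : ℕ :=
  Nat.card {i : Fin n // ∃ h : (i : ℕ) + 1 < n, π i < π ⟨(i : ℕ) + 1, h⟩}

/-- Steps of a Motzkin path. -/
inductive MStep : Type
  | up : MStep
  | hor : MStep
  | down : MStep
deriving DecidableEq

/-- The height change of a Motzkin-path step. -/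
def mval : MStep → ℤ
  | .up => 1
  | .hor => 0
  | .down => -1

/-- A Motzkin path: ends at height 0 and never goes below 0. -/
def IsMotzkinPath (P : List MStep) : Prop :=
  (P.map mval).sum = 0 ∧ ∀ p : List MStep, p <+: P → 0 ≤ (p.map mval).sum

/-- The height of a Motzkin path: the maximal height reached. -/
def pathHeight (P : List MStep) : ℤ :=
  (((List.range (P.length + 1)).map fun i => ((P.take i).map mval).sum).foldr max 0)

/-- Binary-unary trees encoding both families. -/
inductive MT : Type
  | nil : MT
  | H : MT → MT
  | U : MT → MT → MT

namespace MT

def size : MT → ℕ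
  | nil => 0
  | H t => size t + 1
  | U a b => size a + size b + 2

def ups : MT → ℕ
  | nil => 0
  | H t => ups t
  | U a b => ups a + 1 + ups b

def dd : MT → ℕ
  | nil => 0
  | H t => 1 + dd t
  | U a b => dd a + 1 + dd b

def hgt : MT → ℕ
  | nil => 0
  | H t => hgt t
  | U a b => max (hgt a + 1) (hgt b)

def ll : MT → ℕ
  | nil => 0
  | H t => max 1 (ll t)
  | U a b => max (max (ll a) 1 + 1) (ll b)

theorem ll_hgt (t : MT) : hgt t + 1 = max 1 (ll t) := by
  induction t with
  | nil => simp [hgt, ll]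
  | H t ih => simp only [hgt, ll]; omega
  | U a b iha ihb => simp only [hgt, ll]; omega

theorem ll_hgt' (t : MT) (h : 1 ≤ size t) : ll t = hgt t + 1 := by
  have := ll_hgt t
  cases t with
  | nil => simp [size] at h
  | H t => simp only [hgt, ll] at *; omega
  | U a b => simp only [hgt, ll] at *; omega

def toPath : MT → List MStep
  | nil => []
  | H t => .hor :: toPath t
  | U a b => .up :: (toPath a ++ .down :: toPath b)

def pl : MT → ℕ → List ℕ
  | nil, _ => []
  | H t, c => [c + size t] ++ pl t c
  | U a b, c => ((pl a (c + size b + 1) ++ [c + size b]) ++ [c + size b + 1 + size a]) ++ pl b c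

/-! ### paths -/

theorem toPath_length (t : MT) : (toPath t).length = size t := by
  induction t with
  | nil => rfl
  | H t ih => simp [toPath, size, ih]
  | U a b iha ihb => simp [toPath, size, iha, ihb]; omega

theorem toPath_up (t : MT) : (toPath t).count .up = ups t := by
  induction t with
  | nil => rfl
  | H t ih => simp [toPath, ups, ih]
  | U a b iha ihb => simp [toPath, ups, iha, ihb]; omega

theorem toPath_dd (t : MT) : (toPath t).count .up + (toPath t).count .hor = dd t := by
  induction t with
  | nil => rfl
  | H t ih => simp [toPath, dd, ← ih]; omega
  | U a b iha ihb => simp [toPath, dd, ← iha, ← ihb]; omega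

def dn (r : List MStep) : Prop := r = [] ∨ ∃ r', r = .down :: r'

theorem toPath_inj_aux (a : MT) : ∀ (a' : MT) (r r' : List MStep), dn r → dn r' →
    toPath a ++ r = toPath a' ++ r' → a = a' ∧ r = r' := by
  induction a with
  | nil =>
    intro a' r r' h h' e
    cases a' <;> rcases h with rfl | ⟨_, rfl⟩ <;> simp_all [toPath]
  | H t ih =>
    intro a' r r' h h' e
    cases a' with
    | nil => rcases h' with rfl | ⟨_, rfl⟩ <;> simp_all [toPath]
    | H t' =>
      simp only [toPath, List.cons_append, List.cons.injEq, true_and] at e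
      obtain ⟨rfl, rfl⟩ := ih _ _ _ h h' e
      simp
    | U => simp [toPath] at e
  | U a b iha ihb =>
    intro a' r r' h h' e
    cases a' with
    | nil => rcases h' with rfl | ⟨_, rfl⟩ <;> simp_all [toPath]
    | H t' => simp [toPath] at e
    | U a' b' =>
      simp only [toPath, List.cons_append, List.append_assoc, List.cons.injEq, true_and] at e
      obtain ⟨rfl, e2⟩ := iha _ _ _ (Or.inr ⟨_, rfl⟩) (Or.inr ⟨_, rfl⟩) e
      simp only [List.cons.injEq, true_and] at e2
      obtain ⟨rfl, rfl⟩ := ihb _ _ _ h h' e2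
      simp

theorem toPath_inj {a b : MT} (h : toPath a = toPath b) : a = b :=
  (toPath_inj_aux a b [] [] (Or.inl rfl) (Or.inl rfl) (by simpa using h)).1

def VV : ℕ → List MStep → Prop
  | h, [] => h = 0
  | h, .up :: P => VV (h + 1) P
  | h, .hor :: P => VV h P
  | 0, .down :: _ => False
  | h + 1, .down :: P => VV h P

theorem prefix_cons_all {Q : List MStep → Prop} {x : MStep} {P : List MStep} :
    (∀ p, p <+: x :: P → Q p) ↔ Q [] ∧ ∀ p, p <+: P → Q (x :: p) := by
  constructor
  · intro h
    exact ⟨h _ (List.nil_prefix), fun p hp => h _ (by simpa using hp)⟩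
  · rintro ⟨h0, h1⟩ p hp
    rcases p with _ | ⟨y, p⟩
    · exact h0
    · rw [List.cons_prefix_cons] at hp
      obtain ⟨rfl, hp⟩ := hp
      exact h1 p hp

theorem VV_iff (P : List MStep) : ∀ h : ℕ, VV h P ↔
    ((h : ℤ) + (P.map mval).sum = 0 ∧ ∀ p : List MStep, p <+: P → 0 ≤ (h : ℤ) + (p.map mval).sum) := by
  induction P with
  | nil => intro h; simp [VV]
  | cons x P ih =>
    intro h
    rw [prefix_cons_all]
    rcases x with _ | _ | _
    · simp only [VV, ih]; simp [mval, add_assoc]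
    · simp only [VV, ih]; simp [mval]
    · rcases h with _ | h
      · simp only [VV, false_iff]
        rintro ⟨-, -, h⟩
        have := h [] List.nil_prefix
        simp [mval] at this
      · simp only [VV, ih]; simp [mval]
        intro _ _
        positivity

theorem isMotzkinPath_iff (P : List MStep) : IsMotzkinPath P ↔ VV 0 P := by
  rw [VV_iff]; simp [IsMotzkinPath]

theorem VV_toPath (t : MT) : ∀ h r, VV h (toPath t ++ r) ↔ VV h r := by
  induction t with
  | nil => simp [toPath]
  | H t ih => intro h r; simp [toPath, VV, ih]
  | U a b iha ihb => intro h r; simp [toPath, VV, iha, ihb]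

theorem VV_decomp (N : ℕ) : ∀ (P : List MStep) (h : ℕ), P.length ≤ N → VV h P →
    ∃ t r, P = toPath t ++ r ∧ ((h = 0 ∧ r = []) ∨ ∃ h' r', h = h' + 1 ∧ r = .down :: r' ∧ VV h' r') := by
  induction N with
  | zero =>
    intro P h hP hV
    obtain rfl : P = [] := by simpa using hP
    exact ⟨nil, [], rfl, Or.inl ⟨hV, rfl⟩⟩
  | succ N ih =>
    intro P h hP hV
    rcases P with _ | ⟨x, P⟩
    · exact ⟨nil, [], rfl, Or.inl ⟨hV, rfl⟩⟩
    · simp only [List.length_cons, Nat.add_le_add_iff_right] at hP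
      rcases x with _ | _ | _
      · obtain ⟨a, r, rfl, h1 | ⟨h', r', e, rfl, hV'⟩⟩ := ih P (h + 1) hP hV
        · omega
        · obtain rfl : h = h' := by omega
          obtain ⟨b, s, rfl, h2⟩ := ih r' h (by simp at hP; omega) hV'
          exact ⟨U a b, s, by simp [toPath], h2⟩
      · obtain ⟨a, r, rfl, h1⟩ := ih P h hP hV
        exact ⟨H a, r, by simp [toPath], h1⟩
      · rcases h with _ | h
        · exact hV.elim
        · exact ⟨nil, _, rfl, Or.inr ⟨h, P, rfl, rfl, hV⟩⟩

theorem toPath_motzkin (t : MT) : IsMotzkinPath (toPath t) := by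
  rw [isMotzkinPath_iff]
  have := VV_toPath t 0 []
  simpa [VV] using this

theorem toPath_surj {P : List MStep} (h : IsMotzkinPath P) : ∃ t, toPath t = P := by
  rw [isMotzkinPath_iff] at h
  obtain ⟨t, r, rfl, ⟨_, rfl⟩ | ⟨h', _, e, _⟩⟩ := VV_decomp _ P 0 le_rfl h
  · exact ⟨t, by simp⟩
  · omega

theorem foldr_max_le (L : List ℤ) (x : ℤ) : L.foldr max 0 ≤ x ↔ 0 ≤ x ∧ ∀ y ∈ L, y ≤ x := by
  induction L with
  | nil => simp
  | cons a L ih => simp [ih]; tauto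

theorem pathHeight_le (P : List MStep) (x : ℤ) :
    pathHeight P ≤ x ↔ ∀ i ≤ P.length, ((P.take i).map mval).sum ≤ x := by
  unfold pathHeight
  rw [foldr_max_le]
  simp only [List.mem_map, List.mem_range, Nat.lt_succ_iff]
  constructor
  · rintro ⟨_, h⟩ i hi
    exact h _ ⟨i, hi, rfl⟩
  · intro h
    refine ⟨by simpa using h 0 (by simp), ?_⟩
    rintro y ⟨i, hi, rfl⟩
    exact h i hi

theorem pathHeight_cons (s : MStep) (P : List MStep) :
    pathHeight (s :: P) = max 0 (mval s + pathHeight P) := by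
  apply eq_of_forall_ge_iff
  intro x
  have : mval s + pathHeight P ≤ x ↔ pathHeight P ≤ x - mval s := by constructor <;> intro <;> omega
  rw [max_le_iff, this, pathHeight_le, pathHeight_le]
  constructor
  · intro h
    refine ⟨by simpa using h 0 (by simp), fun i hi => ?_⟩
    have := h (i + 1) (by simpa using hi)
    simp only [List.take_succ_cons, List.map_cons, List.sum_cons] at this
    omega
  · rintro ⟨h0, h1⟩ i hi
    rcases i with _ | i
    · simpa using h0
    · have := h1 i (by simpa using hi)
      simp only [List.take_succ_cons, List.map_cons, List.sum_cons]
      omega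

theorem pathHeight_append (P Q : List MStep) :
    pathHeight (P ++ Q) = max (pathHeight P) ((P.map mval).sum + pathHeight Q) := by
  have hQ : 0 ≤ pathHeight Q := by
    have := (pathHeight_le Q _).1 le_rfl 0 (by simp)
    simpa using this
  induction P with
  | nil => simp [pathHeight, ] at *; exact hQ
  | cons s P ih =>
    simp only [List.cons_append, pathHeight_cons, ih, List.map_cons, List.sum_cons]
    omega

theorem toPath_hgt (t : MT) : pathHeight (toPath t) = hgt t := by
  induction t with
  | nil => simp [toPath, hgt, pathHeight]
  | H t ih => simp [toPath, hgt, pathHeight_cons, ih, mval]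
  | U a b iha ihb =>
    have := (toPath_motzkin a).1
    simp only [toPath, hgt, pathHeight_cons, pathHeight_append, iha, ihb, mval, this]
    push_cast
    omega

/-! ### lists -/

def A132 (l : List ℕ) : Prop :=
  ∀ i j k (hij : i < j) (hjk : j < k) (hk : k < l.length), ¬ (l[i] < l[k] ∧ l[k] < l[j])

def A123 (l : List ℕ) : Prop :=
  ∀ a b (hab : a < b) (hb : b + 1 < l.length), ¬ (l[a] < l[b] ∧ l[b] < l[b + 1])

def HasL (R : ℕ → ℕ → Prop) (l : List ℕ) (k : ℕ) : Prop :=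
  (∃ s : List ℕ, s.Sublist l ∧ s.Pairwise R ∧ s.length = k) ∧
    ∀ s : List ℕ, s.Sublist l → s.Pairwise R → s.length ≤ k

def risesL : List ℕ → ℕ
  | [] => 0
  | [_] => 0
  | x :: y :: l => (if x < y then 1 else 0) + risesL (y :: l)

/-- every entry of `l₁` exceeds every entry of `l₂` -/
def GT (l₁ l₂ : List ℕ) : Prop := ∀ x ∈ l₁, ∀ y ∈ l₂, y < x

theorem pl_length (t : MT) : ∀ c, (pl t c).length = size t := by
  induction t with
  | nil => simp [pl, size]
  | H t ih => intro c; simp [pl, size, ih]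
  | U a b iha ihb => intro c; simp [pl, size, iha, ihb]; omega

theorem pl_perm (t : MT) : ∀ c, (pl t c).Perm (List.range' c (size t)) := by
  induction t with
  | nil => simp [pl, size]
  | H t ih =>
    intro c
    simp only [pl, size]
    rw [← List.range'_append_1]
    exact (List.perm_append_comm).trans ((ih c).append (by simp))
  | U a b iha ihb =>
    intro c
    have e : List.range' c (size (U a b)) = List.range' c (size b) ++
        ([c + size b] ++ (List.range' (c + size b + 1) (size a) ++ [c + size b + 1 + size a])) := by
      have h1 : [c + size b] = List.range' (c + size b) 1 := rfl
      have h2 : [c + size b + 1 + size a] = List.range' (c + size b + 1 + size a) 1 := rfl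
      rw [h1, h2, List.range'_append_1, List.range'_append_1, List.range'_append_1]
      congr 1; simp only [size]; omega
    rw [e]
    simp only [pl]
    refine (List.perm_append_comm).trans ((ihb c).append ?_)
    rw [← List.append_assoc]
    refine List.Perm.append ?_ (List.Perm.refl _)
    exact (List.perm_append_comm).trans ((List.Perm.refl _).append (iha _))

theorem pl_mem {t : MT} {c x : ℕ} : x ∈ pl t c ↔ c ≤ x ∧ x < c + size t := by
  rw [(pl_perm t c).mem_iff, List.mem_range'_1]

theorem pl_inj (t : MT) : ∀ (t' : MT) (c : ℕ), pl t c = pl t' c → t = t' := by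
  induction t with
  | nil =>
    intro t' c h
    have := congrArg List.length h
    rw [pl_length, pl_length] at this
    cases t' <;> simp_all [size]
  | H t ih =>
    intro t' c h
    have hs := congrArg List.length h
    rw [pl_length, pl_length] at hs
    cases t' with
    | nil => simp [size] at hs
    | H t' =>
      simp only [pl, List.cons_append, List.nil_append, List.cons.injEq] at h
      rw [ih _ _ h.2]
    | U a b =>
      exfalso
      simp only [size] at hs
      have e : c + size t = c + size b + 1 + size a := by omega
      simp only [pl, List.append_assoc, List.cons_append, List.nil_append, e] at h
      rcases ha : pl a (c + size b + 1) with _ | ⟨x, s⟩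
      · rw [ha] at h
        simp at h
        omega
      · have : x ∈ pl a (c + size b + 1) := by rw [ha]; simp
        rw [pl_mem] at this
        rw [ha] at h
        simp at h
        omega
  | U a b iha ihb =>
    intro t' c h
    have hs := congrArg List.length h
    rw [pl_length, pl_length] at hs
    cases t' with
    | nil => simp [size] at hs
    | H t =>
      exfalso
      simp only [size] at hs
      have e : c + size t = c + size b + 1 + size a := by omega
      simp only [pl, List.append_assoc, List.cons_append, List.nil_append, e] at h
      rcases ha : pl a (c + size b + 1) with _ | ⟨x, s⟩
      · rw [ha] at h
        simp at h
        omega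
      · have : x ∈ pl a (c + size b + 1) := by rw [ha]; simp
        rw [pl_mem] at this
        rw [ha] at h
        simp at h
        omega
    | U a' b' =>
      simp only [size] at hs
      have e : c + size b' + 1 + size a' = c + size b + 1 + size a := by omega
      simp only [pl] at h
      rw [e] at h
      rw [List.append_assoc _ [_] (pl b c), List.append_assoc _ [_] (pl b' c)] at h
      simp only [List.cons_append, List.nil_append] at h
      have h2 := List.append_cons_inj_of_notMem (a₁ := c + size b + 1 + size a)
        (a₂ := c + size b + 1 + size a) (x₁ := pl a (c + size b + 1) ++ [c + size b])
        (x₂ := pl a' (c + size b' + 1) ++ [c + size b']) (z₁ := pl b c) (z₂ := pl b' c)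
        (by simp [pl_mem]; omega) (by simp [pl_mem]; omega)
      obtain ⟨h3, -, h4⟩ := h2.1 h
      obtain rfl := ihb _ _ h4
      rw [List.append_left_inj] at h3
      rw [iha _ _ h3]

theorem GT_pl_head {t : MT} {c : ℕ} : GT [c + size t] (pl t c) := by
  intro x hx y hy
  rw [pl_mem] at hy
  simp at hx
  omega

theorem GT_pl_min {t : MT} {c : ℕ} : GT (pl t (c + 1)) [c] := by
  intro x hx y hy
  rw [pl_mem] at hx
  simp at hy
  omega

theorem GT_pl_big {a b : MT} {c : ℕ} :
    GT ((pl a (c + size b + 1) ++ [c + size b]) ++ [c + size b + 1 + size a]) (pl b c) := by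
  intro x hx y hy
  rw [pl_mem] at hy
  simp [pl_mem] at hx
  omega

theorem pl_lt_top {a : MT} {c : ℕ} :
    ∀ x ∈ (pl a (c + 1) ++ [c]), x < c + 1 + size a := by
  intro x hx
  simp [pl_mem] at hx
  omega

/-! ### statistics of sums of lists -/

theorem HasL_nil (R : ℕ → ℕ → Prop) : HasL R [] 0 := by
  refine ⟨⟨[], by simp⟩, ?_⟩
  intro s hs _
  simp at hs
  simp [hs]

theorem HasL_singleton (R : ℕ → ℕ → Prop) (x : ℕ) : HasL R [x] 1 := by
  refine ⟨⟨[x], by simp⟩, ?_⟩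
  intro s hs _
  simpa using hs.length_le

theorem HasL_lt_append {l₁ l₂ : List ℕ} {k₁ k₂ : ℕ} (h : GT l₁ l₂)
    (h₁ : HasL (· < ·) l₁ k₁) (h₂ : HasL (· < ·) l₂ k₂) : HasL (· < ·) (l₁ ++ l₂) (max k₁ k₂) := by
  obtain ⟨⟨s₁, a₁, b₁, c₁⟩, m₁⟩ := h₁
  obtain ⟨⟨s₂, a₂, b₂, c₂⟩, m₂⟩ := h₂
  constructor
  · rcases le_total k₁ k₂ with hk | hk
    · exact ⟨s₂, a₂.trans (List.sublist_append_right _ _), b₂, by omega⟩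
    · exact ⟨s₁, a₁.trans (List.sublist_append_left _ _), b₁, by omega⟩
  · intro s hs hp
    rw [List.sublist_append_iff] at hs
    obtain ⟨u, v, rfl, hu, hv⟩ := hs
    rw [List.pairwise_append] at hp
    have hu' := m₁ u hu hp.1
    have hv' := m₂ v hv hp.2.1
    rcases u with _ | ⟨x, u⟩
    · simp; omega
    · rcases v with _ | ⟨y, v⟩
      · simp at *; omega
      · have e1 := hp.2.2 x (by simp) y (by simp)
        have e2 := h x (hu.subset (by simp)) y (hv.subset (by simp))
        omega

theorem HasL_gt_append {l₁ l₂ : List ℕ} {k₁ k₂ : ℕ} (h : GT l₁ l₂)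
    (h₁ : HasL (· > ·) l₁ k₁) (h₂ : HasL (· > ·) l₂ k₂) : HasL (· > ·) (l₁ ++ l₂) (k₁ + k₂) := by
  obtain ⟨⟨s₁, a₁, b₁, c₁⟩, m₁⟩ := h₁
  obtain ⟨⟨s₂, a₂, b₂, c₂⟩, m₂⟩ := h₂
  constructor
  · refine ⟨s₁ ++ s₂, a₁.append a₂, ?_, by simp [c₁, c₂]⟩
    rw [List.pairwise_append]
    exact ⟨b₁, b₂, fun x hx y hy => h x (a₁.subset hx) y (a₂.subset hy)⟩
  · intro s hs hp
    rw [List.sublist_append_iff] at hs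
    obtain ⟨u, v, rfl, hu, hv⟩ := hs
    rw [List.pairwise_append] at hp
    have hu' := m₁ u hu hp.1
    have hv' := m₂ v hv hp.2.1
    simp; omega

theorem HasL_lt_top {l : List ℕ} {k M : ℕ} (h : ∀ x ∈ l, x < M)
    (h₁ : HasL (· < ·) l k) : HasL (· < ·) (l ++ [M]) (k + 1) := by
  obtain ⟨⟨s₁, a₁, b₁, c₁⟩, m₁⟩ := h₁
  constructor
  · refine ⟨s₁ ++ [M], a₁.append (List.Sublist.refl _), ?_, by simp [c₁]⟩
    rw [List.pairwise_append]
    exact ⟨b₁, by simp, fun x hx y hy => by simp at hy; subst hy; exact h x (a₁.subset hx)⟩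
  · intro s hs hp
    rw [List.sublist_append_iff] at hs
    obtain ⟨u, v, rfl, hu, hv⟩ := hs
    rw [List.pairwise_append] at hp
    have hu' := m₁ u hu hp.1
    have hv' := hv.length_le
    simp at *; omega

theorem HasL_gt_top {l : List ℕ} {k M : ℕ} (h : ∀ x ∈ l, x < M) (hk : 1 ≤ k)
    (h₁ : HasL (· > ·) l k) : HasL (· > ·) (l ++ [M]) k := by
  obtain ⟨⟨s₁, a₁, b₁, c₁⟩, m₁⟩ := h₁
  constructor
  · exact ⟨s₁, a₁.trans (List.sublist_append_left _ _), b₁, c₁⟩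
  · intro s hs hp
    rw [List.sublist_append_iff] at hs
    obtain ⟨u, v, rfl, hu, hv⟩ := hs
    rw [List.pairwise_append] at hp
    have hu' := m₁ u hu hp.1
    have hv' := hv.length_le
    rcases u with _ | ⟨x, u⟩
    · simp at *; omega
    · rcases v with _ | ⟨y, v⟩
      · simp at *; omega
      · have e1 := hp.2.2 x (by simp) y (by simp)
        have e2 := h x (hu.subset (by simp))
        have e3 : y ∈ [M] := hv.subset (by simp)
        simp at e3
        omega

theorem risesL_append : ∀ {l₁ l₂ : List ℕ}, GT l₁ l₂ → risesL (l₁ ++ l₂) = risesL l₁ + risesL l₂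
  | [], l₂, _ => by simp [risesL]
  | [x], [], _ => by simp [risesL]
  | [x], y :: l, h => by
    have := h x (by simp) y (by simp)
    simp only [List.cons_append, List.nil_append, risesL]
    rw [if_neg (by omega)]
  | x :: y :: l, l₂, h => by
    have := risesL_append (l₁ := y :: l) (l₂ := l₂) (fun a ha b hb => h a (List.mem_cons_of_mem _ ha) b hb)
    simp only [List.cons_append, risesL] at *
    rw [this]; omega

theorem risesL_top {M : ℕ} : ∀ {l : List ℕ}, l ≠ [] → (∀ x ∈ l, x < M) →
    risesL (l ++ [M]) = risesL l + 1
  | [], h, _ => by simp at h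
  | [x], _, h => by
    have := h x (by simp)
    simp [risesL, this]
  | x :: y :: l, _, h => by
    have := risesL_top (l := y :: l) (by simp) (fun a ha => h a (List.mem_cons_of_mem _ ha))
    simp only [List.cons_append, risesL] at *
    rw [this]; omega

theorem A132_append {l₁ l₂ : List ℕ} (h : GT l₁ l₂) (h₁ : A132 l₁) (h₂ : A132 l₂) :
    A132 (l₁ ++ l₂) := by
  intro i j k hij hjk hk
  have H : ∀ i (hi : i < l₁.length) j (hj : j < l₂.length), l₂[j] < l₁[i] :=
    fun i hi j hj => h _ (List.getElem_mem _) _ (List.getElem_mem _)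
  simp only [List.length_append] at hk
  by_cases hk1 : k < l₁.length
  · have := h₁ i j k hij hjk hk1
    rwa [List.getElem_append_left hk1, List.getElem_append_left, List.getElem_append_left]
  · by_cases hi1 : i < l₁.length
    · have := H i hi1 (k - l₁.length) (by omega)
      rw [List.getElem_append_left hi1, List.getElem_append_right (i := k) (by omega)]
      omega
    · have := h₂ (i - l₁.length) (j - l₁.length) (k - l₁.length) (by omega) (by omega) (by omega)
      rwa [List.getElem_append_right (by omega), List.getElem_append_right (by omega),
        List.getElem_append_right (by omega)]

theorem A123_append {l₁ l₂ : List ℕ} (h : GT l₁ l₂) (h₁ : A123 l₁) (h₂ : A123 l₂) :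
    A123 (l₁ ++ l₂) := by
  intro a b hab hb
  have H : ∀ i (hi : i < l₁.length) j (hj : j < l₂.length), l₂[j] < l₁[i] :=
    fun i hi j hj => h _ (List.getElem_mem _) _ (List.getElem_mem _)
  simp only [List.length_append] at hb
  by_cases hk1 : b + 1 < l₁.length
  · have := h₁ a b hab hk1
    rwa [List.getElem_append_left hk1, List.getElem_append_left, List.getElem_append_left]
  · by_cases hb1 : b < l₁.length
    · have := H b hb1 (b + 1 - l₁.length) (by omega)
      rw [List.getElem_append_left hb1, List.getElem_append_right (i := b + 1) (by omega)]
      omega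
    · by_cases ha1 : a < l₁.length
      · have := H a ha1 (b - l₁.length) (by omega)
        rw [List.getElem_append_left ha1, List.getElem_append_right (i := b) (by omega)]
        omega
      · have := h₂ (a - l₁.length) (b - l₁.length) (by omega) (by omega)
        have e : b - l₁.length + 1 = b + 1 - l₁.length := by omega
        simp only [e] at this
        rwa [List.getElem_append_right (by omega), List.getElem_append_right (by omega),
          List.getElem_append_right (by omega)]

theorem A132_top {l : List ℕ} {M : ℕ} (h : ∀ x ∈ l, x < M) (h₁ : A132 l) : A132 (l ++ [M]) := by
  intro i j k hij hjk hk
  simp only [List.length_append, List.length_singleton] at hk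
  by_cases hk1 : k < l.length
  · have := h₁ i j k hij hjk hk1
    rwa [List.getElem_append_left hk1, List.getElem_append_left, List.getElem_append_left]
  · have := h _ (List.getElem_mem (show j < l.length by omega))
    rw [List.getElem_append_right (i := k) (by omega), List.getElem_append_left (i := j) (by omega)]
    simp
    omega

theorem A123_top {l : List ℕ} {k M : ℕ} (h' : GT l [k])
    (h₁ : A123 (l ++ [k])) : A123 (l ++ [k] ++ [M]) := by
  intro a b hab hb
  simp only [List.length_append, List.length_singleton] at hb
  by_cases hk1 : b + 1 < (l ++ [k]).length
  · have := h₁ a b hab hk1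
    rwa [List.getElem_append_left hk1, List.getElem_append_left (as := l ++ [k]) (i := b) (by omega),
      List.getElem_append_left (as := l ++ [k]) (i := a) (by omega)]
  · simp only [List.length_append, List.length_singleton] at hk1
    obtain rfl : b = l.length := by omega
    have := h' _ (List.getElem_mem (show a < l.length by omega)) k (by simp)
    simp only [List.append_assoc]
    rw [List.getElem_append_left (i := a) (by omega), List.getElem_append_right (i := l.length) (by omega)]
    simp
    omega

theorem A132_sub {p l q : List ℕ} (h : A132 (p ++ l ++ q)) : A132 l := by
  intro i j k hij hjk hk
  have := h (p.length + i) (p.length + j) (p.length + k) (by omega) (by omega) (by simp; omega)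
  have e : ∀ i (hi : i < l.length), (p ++ l ++ q)[p.length + i]'(by simp; omega) = l[i] := by
    intro i hi
    rw [List.getElem_append_left (by simp; omega), List.getElem_append_right (by omega)]
    simp
  rwa [e, e, e] at this

theorem A123_sub {p l q : List ℕ} (h : A123 (p ++ l ++ q)) : A123 l := by
  intro a b hab hb
  have := h (p.length + a) (p.length + b) (by omega) (by simp; omega)
  have e : ∀ i (hi : i < l.length), (p ++ l ++ q)[p.length + i]'(by simp; omega) = l[i] := by
    intro i hi
    rw [List.getElem_append_left (by simp; omega), List.getElem_append_right (by omega)]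
    simp
  simp only [add_assoc] at this
  rwa [e, e, e] at this

theorem pl_A132 (t : MT) : ∀ c, A132 (pl t c) := by
  have h1 : ∀ x, A132 [x] := by intro x i j k _ _ hk; simp at hk; omega
  induction t with
  | nil => intro c i j k _ _ hk; simp [pl] at hk
  | H t ih => intro c; exact A132_append GT_pl_head (h1 _) (ih c)
  | U a b iha ihb =>
    intro c
    exact A132_append GT_pl_big (A132_top pl_lt_top (A132_append GT_pl_min (iha _) (h1 _))) (ihb c)

theorem pl_A123 (t : MT) : ∀ c, A123 (pl t c) := by
  have h1 : ∀ x, A123 [x] := by intro x i j _ hk; simp at hk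
  induction t with
  | nil => intro c i j _ hk; simp [pl] at hk
  | H t ih => intro c; exact A123_append GT_pl_head (h1 _) (ih c)
  | U a b iha ihb =>
    intro c
    exact A123_append GT_pl_big (A123_top GT_pl_min (A123_append GT_pl_min (iha _) (h1 _))) (ihb c)

theorem pl_rises (t : MT) : ∀ c, risesL (pl t c) = ups t := by
  induction t with
  | nil => intro c; rfl
  | H t ih => intro c; rw [pl, risesL_append GT_pl_head, ih]; simp [risesL, ups]
  | U a b iha ihb =>
    intro c
    rw [pl, risesL_append GT_pl_big, risesL_top (by simp) pl_lt_top, risesL_append GT_pl_min, iha, ihb]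
    simp [risesL, ups]

theorem pl_ll (t : MT) : ∀ c, HasL (· < ·) (pl t c) (ll t) := by
  induction t with
  | nil => intro c; exact HasL_nil _
  | H t ih => intro c; exact HasL_lt_append GT_pl_head (HasL_singleton _ _) (ih c)
  | U a b iha ihb =>
    intro c
    exact HasL_lt_append GT_pl_big (HasL_lt_top pl_lt_top
      (HasL_lt_append GT_pl_min (iha _) (HasL_singleton _ _))) (ihb c)

theorem pl_dd (t : MT) : ∀ c, HasL (· > ·) (pl t c) (dd t) := by
  induction t with
  | nil => intro c; exact HasL_nil _
  | H t ih => intro c; exact HasL_gt_append GT_pl_head (HasL_singleton _ _) (ih c)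
  | U a b iha ihb =>
    intro c
    exact HasL_gt_append GT_pl_big (HasL_gt_top pl_lt_top (by omega)
      (HasL_gt_append GT_pl_min (iha _) (HasL_singleton _ _))) (ihb c)

/-! ### surjectivity -/

theorem perm_split {l₁ l₂ : List ℕ} {c n : ℕ} (h : GT l₁ l₂) (hp : (l₁ ++ l₂).Perm (List.range' c n)) :
    l₂.Perm (List.range' c l₂.length) ∧ l₁.Perm (List.range' (c + l₂.length) l₁.length) := by
  have hn : n = l₂.length + l₁.length := by
    have := hp.length_eq
    simp at this
    omega
  subst hn
  have hnd : (l₁ ++ l₂).Nodup := hp.nodup_iff.2 List.nodup_range'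
  have p1 : (l₁.mergeSort (· ≤ ·)).Perm l₁ := List.mergeSort_perm _ _
  have p2 : (l₂.mergeSort (· ≤ ·)).Perm l₂ := List.mergeSort_perm _ _
  have s1 : (l₁.mergeSort (· ≤ ·)).Pairwise (· ≤ ·) := by
    simpa using List.pairwise_mergeSort (le := fun a b : ℕ => decide (a ≤ b)) (by simp; omega) (by simp; omega) l₁
  have s2 : (l₂.mergeSort (· ≤ ·)).Pairwise (· ≤ ·) := by
    simpa using List.pairwise_mergeSort (le := fun a b : ℕ => decide (a ≤ b)) (by simp; omega) (by simp; omega) l₂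
  have s : (l₂.mergeSort (· ≤ ·) ++ l₁.mergeSort (· ≤ ·)).Pairwise (· ≤ ·) := by
    rw [List.pairwise_append]
    refine ⟨s2, s1, fun a ha b hb => ?_⟩
    exact (h b (p1.mem_iff.1 hb) a (p2.mem_iff.1 ha)).le
  have e : l₂.mergeSort (· ≤ ·) ++ l₁.mergeSort (· ≤ ·) =
      List.range' c l₂.length ++ List.range' (c + l₂.length) l₁.length := by
    rw [List.range'_append_1]
    refine List.Perm.eq_of_pairwise (le := (· ≤ ·)) (fun a b _ _ h1 h2 => le_antisymm h1 h2) s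
      (List.pairwise_le_range') ?_
    exact ((p2.append p1).trans List.perm_append_comm).trans hp
  obtain ⟨e1, e2⟩ := List.append_inj e (by simp)
  rw [← e1, ← e2]
  exact ⟨p2.symm, p1.symm⟩

theorem pl_surj (n : ℕ) : ∀ (c : ℕ) (l : List ℕ), l.Perm (List.range' c n) → A132 l → A123 l →
    ∃ t, pl t c = l := by
  induction n using Nat.strong_induction_on with
  | _ n ih =>
  intro c l hp h1 h2
  rcases n with _ | n
  · refine ⟨nil, ?_⟩
    simp at hp
    simp [pl, hp]
  have hM : c + n ∈ l := by
    rw [hp.mem_iff, List.mem_range'_1]; omega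
  obtain ⟨s, r, rfl⟩ := List.append_of_mem hM
  have hnd : (s ++ (c + n) :: r).Nodup := hp.nodup_iff.2 List.nodup_range'
  have hle : ∀ x ∈ s ++ (c + n) :: r, x < c + n + 1 := by
    intro x hx
    rw [hp.mem_iff, List.mem_range'_1] at hx
    omega
  have hnd' := List.nodup_append.1 hnd
  have hsM : ∀ x ∈ s, x < c + n := by
    intro x hx
    have := hle x (by simp [hx])
    have := hnd'.2.2 x hx (c + n) (by simp)
    omega
  have hrM : ∀ x ∈ r, x < c + n := by
    intro x hx
    have := hle x (by simp [hx])
    have h3 := hnd'.2.1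
    rw [List.nodup_cons] at h3
    have : x ≠ c + n := fun e => h3.1 (e ▸ hx)
    omega
  have hlen : s.length + r.length = n := by
    have := hp.length_eq
    simp at this
    omega
  have hsr : GT s r := by
    intro x hx y hy
    obtain ⟨i, hi, rfl⟩ := List.getElem_of_mem hx
    obtain ⟨k, hk, rfl⟩ := List.getElem_of_mem hy
    have h3 := h1 i s.length (s.length + 1 + k) (by omega) (by omega) (by simp; omega)
    rw [List.getElem_append_left hi, List.getElem_append_right (i := s.length) (by omega),
      List.getElem_append_right (by omega)] at h3
    have e : s.length + 1 + k - s.length = k + 1 := by omega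
    simp only [e, Nat.sub_self, List.getElem_cons_zero, List.getElem_cons_succ] at h3
    have := hrM _ hy
    have := hnd'.2.2 s[i] hx r[k] (by simp)
    omega
  have hbig : GT (s ++ [c + n]) r := by
    intro x hx y hy
    rw [List.mem_append] at hx
    rcases hx with hx | hx
    · exact hsr x hx y hy
    · simp at hx; subst hx; exact hrM y hy
  have hp' : ((s ++ [c + n]) ++ r).Perm (List.range' c (n + 1)) := by simpa using hp
  obtain ⟨hr, hs⟩ := perm_split hbig hp'
  have hr1 : A132 r := A132_sub (p := s ++ [c + n]) (q := []) (by simpa using h1)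
  have hr2 : A123 r := A123_sub (p := s ++ [c + n]) (q := []) (by simpa using h2)
  obtain ⟨b, hb⟩ := ih r.length (by omega) c r hr hr1 hr2
  have hbl : size b = r.length := by rw [← pl_length b c, hb]
  rcases List.eq_nil_or_concat s with rfl | ⟨s', k, rfl⟩
  · refine ⟨H b, ?_⟩
    simp at hlen
    simp [pl, hb, hbl, hlen]
  · simp only [List.concat_eq_append] at *
    have hk : GT s' [k] := by
      intro x hx y hy
      simp only [List.mem_singleton] at hy
      subst hy
      obtain ⟨i, hi, rfl⟩ := List.getElem_of_mem hx
      have h3 := h2 i s'.length hi (by simp)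
      have h4 := hsM y (by simp)
      have h5 : s'[i] ≠ y := by
        have := (List.nodup_append.1 hnd'.1).2.2
        exact this _ hx _ (by simp)
      simp only [List.append_assoc] at h3
      rw [List.getElem_append_left hi, List.getElem_append_right (i := s'.length) (by omega),
        List.getElem_append_right (i := s'.length + 1) (by omega)] at h3
      simp at h3
      omega
    have hq : GT [c + n] (s' ++ [k]) := by
      intro x hx y hy
      simp at hx; subst hx; exact hsM y hy
    have hs2 : ([c + n] ++ (s' ++ [k])).Perm (List.range' (c + r.length) (s' ++ [k] ++ [c + n]).length) :=
      List.perm_append_comm.trans hs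
    obtain ⟨hs3, -⟩ := perm_split hq hs2
    obtain ⟨hk4, hs4⟩ := perm_split hk hs3
    simp at hk4 hs4 hlen
    obtain ⟨a, ha⟩ := ih s'.length (by omega) _ s' hs4
      (A132_sub (p := []) (q := [k] ++ [c + n] ++ r) (by simpa using h1))
      (A123_sub (p := []) (q := [k] ++ [c + n] ++ r) (by simpa using h2))
    have hal : size a = s'.length := by rw [← pl_length a, ha]
    refine ⟨U a b, ?_⟩
    have hk5 : k = c + r.length := by omega
    simp only [pl, hbl, hal, ha, hb, hk5]
    simp
    omega

/-! ### from permutations to lists -/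

def code {n : ℕ} (π : Equiv.Perm (Fin n)) : List ℕ := List.ofFn fun i => (π i : ℕ)

theorem code_inj {n : ℕ} {π σ : Equiv.Perm (Fin n)} (h : code π = code σ) : π = σ := by
  have := List.ofFn_injective h
  ext i
  exact congrFun this i

theorem code_perm {n : ℕ} (π : Equiv.Perm (Fin n)) : (code π).Perm (List.range' 0 n) := by
  rw [List.perm_ext_iff_of_nodup _ List.nodup_range']
  · intro x
    simp only [code, List.mem_ofFn, List.mem_range'_1]
    constructor
    · rintro ⟨i, rfl⟩
      have := (π i).2
      omega
    · rintro ⟨_, h⟩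
      exact ⟨π.symm ⟨x, by omega⟩, by simp⟩
  · unfold code
    rw [List.nodup_ofFn]
    intro i j h
    exact π.injective (Fin.ext h)

theorem exists_code {n : ℕ} {l : List ℕ} (h : l.Perm (List.range' 0 n)) :
    ∃ π : Equiv.Perm (Fin n), code π = l := by
  have hl : l.length = n := by simpa using h.length_eq
  subst hl
  have hnd : l.Nodup := h.nodup_iff.2 List.nodup_range'
  have hlt : ∀ i : Fin l.length, l[i] < l.length := by
    intro i
    have := h.mem_iff.1 (List.getElem_mem i.2)
    rw [List.mem_range'_1] at this
    simpa using this.2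
  let f : Fin l.length → Fin l.length := fun i => ⟨l[i], hlt i⟩
  have hf : Function.Injective f := by
    intro i j hij
    have : l[i] = l[j] := congrArg Fin.val hij
    exact Fin.ext ((List.Nodup.getElem_inj_iff hnd).1 this)
  refine ⟨Equiv.ofBijective f (Finite.injective_iff_bijective.1 hf), ?_⟩
  simp [code, f]

theorem A132_code {n : ℕ} (π : Equiv.Perm (Fin n)) : A132 (code π) ↔ Avoids132 π := by
  constructor
  · rintro h ⟨i, j, k, hij, hjk, h1, h2⟩
    have := h i j k hij hjk (by simp [code])
    simp [code] at this
    omega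
  · intro h i j k hij hjk hk ⟨h1, h2⟩
    have hk' : k < n := by simpa [code] using hk
    refine h ⟨⟨i, by omega⟩, ⟨j, by omega⟩, ⟨k, hk'⟩, hij, hjk, ?_⟩
    simpa [code] using And.intro h1 h2

theorem A123_code {n : ℕ} (π : Equiv.Perm (Fin n)) : A123 (code π) ↔ Avoids1_23 π := by
  constructor
  · rintro h ⟨a, b, hb, hab, h1, h2⟩
    have := h a b hab (by simpa [code] using hb)
    simp [code] at this
    omega
  · intro h a b hab hb ⟨h1, h2⟩
    have hb' : b + 1 < n := by simpa [code] using hb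
    refine h ⟨⟨a, by omega⟩, ⟨b, by omega⟩, hb', hab, ?_⟩
    simpa [code] using And.intro h1 h2

theorem rises_aux : ∀ (n : ℕ) (f : Fin n → ℕ),
    Nat.card {i : Fin n // ∃ h : (i : ℕ) + 1 < n, f i < f ⟨(i : ℕ) + 1, h⟩} = risesL (List.ofFn f) := by
  intro n
  induction n with
  | zero => intro f; simp [risesL]
  | succ n ih =>
    intro f
    classical
    rcases n with _ | n
    · have : IsEmpty {i : Fin (0 + 1) // ∃ h : (i : ℕ) + 1 < 0 + 1, f i < f ⟨(i : ℕ) + 1, h⟩} :=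
        ⟨fun ⟨i, h, _⟩ => by omega⟩
      rw [Nat.card_of_isEmpty]
      simp [risesL]
    · have := ih (fun i => f i.succ)
      rw [Nat.card_eq_fintype_card, Fintype.card_subtype] at this ⊢
      rw [Fin.card_filter_univ_succ', List.ofFn_succ, List.ofFn_succ, risesL]
      rw [List.ofFn_succ] at this
      rw [← this]
      congr 1
      · simp
        congr
      · congr 1
        ext i
        simp [Fin.succ]

theorem rises_code {n : ℕ} (π : Equiv.Perm (Fin n)) : rises π = risesL (code π) := by
  rw [code, ← rises_aux]
  rfl

theorem sSup_code {n : ℕ} (π : Equiv.Perm (Fin n)) (R : ℕ → ℕ → Prop) {k : ℕ}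
    (h : HasL R (code π) k) :
    sSup {m : ℕ | ∃ f : Fin m → Fin n, StrictMono f ∧ ∀ i j, i < j → R (π (f i)) (π (f j))} = k := by
  obtain ⟨⟨s, a, b, c⟩, m⟩ := h
  apply IsGreatest.csSup_eq
  constructor
  · obtain ⟨f, hf⟩ := List.sublist_iff_exists_fin_orderEmbedding_get_eq.1 a
    subst c
    have hl : (code π).length = n := by simp [code]
    refine ⟨fun i => Fin.cast hl (f i), fun i j hij => ?_, fun i j hij => ?_⟩
    · have := f.strictMono hij
      simpa using this
    · have h3 := List.pairwise_iff_get.1 b i j hij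
      rw [hf, hf] at h3
      simp [code] at h3
      exact h3
  · rintro p ⟨f, hf, hR⟩
    have := m (List.ofFn fun i => (π (f i) : ℕ)) ?_ ?_
    · simpa using this
    · rw [List.sublist_iff_exists_fin_orderEmbedding_get_eq]
      refine ⟨OrderEmbedding.ofStrictMono
        (fun i => Fin.cast (by simp [code]) (f (Fin.cast (by simp) i))) ?_, ?_⟩
      · intro i j hij
        simpa using hf (by simpa using hij)
      · intro i
        simp [code]
        rfl
    · rw [List.pairwise_ofFn]
      exact fun i j hij => hR i j hij

theorem lis_code {n : ℕ} {π : Equiv.Perm (Fin n)} {k : ℕ} (h : HasL (· < ·) (code π) k) :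
    lis π = k := by
  rw [← sSup_code π _ h]
  rfl

theorem lds_code {n : ℕ} {π : Equiv.Perm (Fin n)} {k : ℕ} (h : HasL (· > ·) (code π) k) :
    lds π = k := by
  rw [← sSup_code π _ h]
  rfl

theorem stats_code {n : ℕ} {π : Equiv.Perm (Fin n)} {t : MT} (h : pl t 0 = code π) :
    IsMotzkinPerm π ∧ lds π = dd t ∧ lis π = ll t ∧ rises π = ups t ∧ size t = n := by
  refine ⟨⟨(A132_code π).1 (h ▸ pl_A132 t 0), (A123_code π).1 (h ▸ pl_A123 t 0)⟩,
    lds_code (h ▸ pl_dd t 0), lis_code (h ▸ pl_ll t 0), ?_, ?_⟩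
  · rw [rises_code, ← h, pl_rises]
  · rw [← pl_length t 0, h]; simp [code]

theorem card_perm (n d l r : ℕ) :
    Nat.card {π : Equiv.Perm (Fin n) //
        IsMotzkinPerm π ∧ lds π = d ∧ lis π = l ∧ rises π = r} =
      Nat.card {t : MT // size t = n ∧ dd t = d ∧ ll t = l ∧ ups t = r} := by
  have hex : ∀ π : Equiv.Perm (Fin n), IsMotzkinPerm π → ∃ t, pl t 0 = code π := fun π h =>
    pl_surj n 0 _ (code_perm π) ((A132_code π).2 h.1) ((A123_code π).2 h.2)
  choose F hF using hex
  refine Nat.card_congr (Equiv.ofBijective (fun π => ⟨F π.1 π.2.1, ?_⟩) ⟨?_, ?_⟩)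
  · obtain ⟨π, h1, h2, h3, h4⟩ := π
    obtain ⟨-, e2, e3, e4, e5⟩ := stats_code (hF π h1)
    exact ⟨e5, e2 ▸ h2, e3 ▸ h3, e4 ▸ h4⟩
  · rintro ⟨π, h⟩ ⟨σ, h'⟩ e
    have e' : F π h.1 = F σ h'.1 := congrArg Subtype.val e
    apply Subtype.ext
    apply code_inj
    rw [← hF π h.1, ← hF σ h'.1, e']
  · rintro ⟨t, h1, h2, h3, h4⟩
    obtain ⟨π, hπ⟩ := exists_code (h1 ▸ pl_perm t 0)
    obtain ⟨e1, e2, e3, e4, -⟩ := stats_code hπ.symm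
    refine ⟨⟨π, e1, e2.trans h2, e3.trans h3, e4.trans h4⟩, ?_⟩
    apply Subtype.ext
    exact pl_inj _ _ 0 ((hF π e1).trans hπ)

theorem card_path (n d l r : ℕ) (hn : 1 ≤ n) :
    Nat.card {t : MT // size t = n ∧ dd t = d ∧ ll t = l ∧ ups t = r} =
      Nat.card {P : List MStep // IsMotzkinPath P ∧ P.length = n ∧
        P.count MStep.up + P.count MStep.hor = d ∧
        pathHeight P = (l : ℤ) - 1 ∧ P.count MStep.up = r} := by
  refine Nat.card_congr (Equiv.ofBijective (fun t => ⟨toPath t.1, ?_⟩) ⟨?_, ?_⟩)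
  · obtain ⟨t, h1, h2, h3, h4⟩ := t
    refine ⟨toPath_motzkin t, by rw [toPath_length, h1], by rw [toPath_dd, h2], ?_, by rw [toPath_up, h4]⟩
    change pathHeight (toPath t) = _
    rw [toPath_hgt]
    have := ll_hgt' t (by omega)
    omega
  · rintro ⟨t, h⟩ ⟨t', h'⟩ e
    exact Subtype.ext (toPath_inj (congrArg Subtype.val e))
  · rintro ⟨P, h1, h2, h3, h4, h5⟩
    obtain ⟨t, rfl⟩ := toPath_surj h1
    rw [toPath_length] at h2
    rw [toPath_dd] at h3
    rw [toPath_hgt] at h4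
    rw [toPath_up] at h5
    have := ll_hgt' t (by omega)
    exact ⟨⟨t, h2, h3, by omega, h5⟩, rfl⟩

end MT

/-- The number of Motzkin permutations of length `n ≥ 1` with `lds = d`, `lis = l` and `r`
rises equals the number of Motzkin paths of length `n` with `#up + #hor = d`,
height `l - 1` and `r` up-steps. -/
theorem card_motzkin_perms_stats_eq_card_motzkin_paths (n d l r : ℕ) (hn : 1 ≤ n) :
    Nat.card {π : Equiv.Perm (Fin n) //
        IsMotzkinPerm π ∧ lds π = d ∧ lis π = l ∧ rises π = r} =
      Nat.card {P : List MStep // IsMotzkinPath P ∧ P.length = n ∧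
        P.count MStep.up + P.count MStep.hor = d ∧
        pathHeight P = (l : ℤ) - 1 ∧ P.count MStep.up = r} := by
  rw [MT.card_perm, MT.card_path n d l r hn]
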